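/- arXiv:1809.02529 — 6 statements merged into one kernel-verified Lean document; each statement's English description precedes it below -/
import Mathlib

section
/- Let c, a, d, m, M, q ∈ ℝ with q ≠ 0 and m < M < c, and suppose that for every y ∈ ℝ: y²·(c − y²/2) + a·y + d = (1/2)·(M − y)·(y − m)·((y + (M+m)/2)² + q²). Then there exist L > 0 and a C^∞ function φ : ℝ → ℝ which is periodic with period L, satisfies m ≤ φ(ξ) ≤ M for all ξ, attains both values m and M, satisfies (φ'(ξ))²·(c − φ(ξ)) = φ(ξ)²·(c − φ(ξ)²/2) + a·φ(ξ) + d for all ξ ∈ ℝ, and satisfies the traveling-wave equation −c·φ' + c·φ''' = φ·φ''' + 2φ'·φ'' − 3φ²·φ' on ℝ. -/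
theorem aux_flow (g : ℝ → ℝ) (hg : ContDiff ℝ (⊤ : ℕ∞) g) (hpos : ∀ x, 0 < g x)
    (hper : Function.Periodic g (2 * Real.pi)) :
    ∃ (L : ℝ) (θ : ℝ → ℝ), 0 < L ∧ ContDiff ℝ (⊤ : ℕ∞) θ ∧
      (∀ x, HasDerivAt θ (g (θ x)) x) ∧ (∀ x, θ (x + L) = θ x + 2 * Real.pi) ∧
      Function.Surjective θ := by
  set k : ℝ → ℝ := fun x => (g x)⁻¹ with hk
  have hkc : Continuous k := hg.continuous.inv₀ (fun x => (hpos x).ne')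
  have hkpos : ∀ x, 0 < k x := fun x => inv_pos.mpr (hpos x)
  have hkper : Function.Periodic k (2 * Real.pi) := fun x => by simp only [hk, hper x]
  have hint : ∀ a b, IntervalIntegrable k MeasureTheory.volume a b :=
    fun a b => hkc.intervalIntegrable a b
  set T : ℝ → ℝ := fun x => ∫ t in (0 : ℝ)..x, k t with hT
  have hTd : ∀ x, HasDerivAt T (k x) x := fun x => hkc.integral_hasStrictDerivAt 0 x |>.hasDerivAt
  have hTc : Continuous T := continuous_iff_continuousAt.mpr fun x => (hTd x).continuousAt
  have hTm : StrictMono T := strictMono_of_deriv_pos fun x => by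
    rw [(hTd x).deriv]; exact hkpos x
  have hpi : 0 < 2 * Real.pi := by positivity
  have hLpos : 0 < T (2 * Real.pi) := by
    have := hTm hpi
    simpa [hT] using this
  have hTadd : ∀ x, T (x + 2 * Real.pi) = T x + T (2 * Real.pi) := by
    intro x
    have h1 := hkper.intervalIntegral_add_eq x 0
    have h2 := intervalIntegral.integral_add_adjacent_intervals (hint 0 x) (hint x (x + 2 * Real.pi))
    simp only [hT]
    rw [← h2, h1, zero_add]
  have htop : Filter.Tendsto T Filter.atTop Filter.atTop :=
    hkper.tendsto_atTop_intervalIntegral_of_pos (by simpa [hT] using hLpos) hpi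
  have hbot : Filter.Tendsto T Filter.atBot Filter.atBot :=
    hkper.tendsto_atBot_intervalIntegral_of_pos (by simpa [hT] using hLpos) hpi
  have hTs : Function.Surjective T := hTc.surjective htop hbot
  let e := StrictMono.orderIsoOfSurjective T hTm hTs
  have heT : ∀ x, e x = T x := fun x => rfl
  have hd : ∀ x, HasDerivAt e.symm (g (e.symm x)) x := by
    intro x
    have := (hTd (e.symm x)).of_local_left_inverse (f := T) (g := e.symm) (a := x)
      e.symm.continuous.continuousAt (hkpos _).ne'
      (Filter.Eventually.of_forall fun y => by rw [← heT]; simp)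
    simpa [hk] using this
  refine ⟨T (2 * Real.pi), e.symm, hLpos, ?_, hd, ?_, e.symm.surjective⟩
  · rw [contDiff_infty]
    intro n
    have hdiff : Differentiable ℝ e.symm := fun x => (hd x).differentiableAt
    have hder : deriv e.symm = fun x => g (e.symm x) := funext fun x => (hd x).deriv
    induction n with
    | zero => exact contDiff_zero.mpr hdiff.continuous
    | succ n ih =>
      push_cast
      rw [contDiff_succ_iff_deriv]
      refine ⟨hdiff, by simp, ?_⟩
      rw [hder]
      exact (contDiff_infty.mp hg n).comp ih
  · intro x
    apply e.injective
    rw [e.apply_symm_apply, heT, hTadd, ← heT (e.symm x), e.apply_symm_apply]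


/-- Smooth periodic traveling waves of the mCH equation in the case `m < M < c` of two
simple real zeros of the quartic `P(y) = y²(c - y²/2) + ay + d`. -/
theorem mCH_smooth_periodic_two_zeros (c a d m M q : ℝ) (hq : q ≠ 0)
    (hmM : m < M) (hMc : M < c)
    (hfac : ∀ y : ℝ,
      y ^ 2 * (c - y ^ 2 / 2) + a * y + d =
        (1 / 2) * (M - y) * (y - m) * ((y + (M + m) / 2) ^ 2 + q ^ 2)) :
    ∃ (L : ℝ) (φ : ℝ → ℝ), 0 < L ∧
      ContDiff ℝ (⊤ : ℕ∞) φ ∧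
      Function.Periodic φ L ∧
      (∀ ξ : ℝ, m ≤ φ ξ ∧ φ ξ ≤ M) ∧
      (∃ ξ : ℝ, φ ξ = m) ∧ (∃ ξ : ℝ, φ ξ = M) ∧
      (∀ ξ : ℝ,
        (deriv φ ξ) ^ 2 * (c - φ ξ) =
          (φ ξ) ^ 2 * (c - (φ ξ) ^ 2 / 2) + a * φ ξ + d) ∧
      (∀ ξ : ℝ,
        -c * deriv φ ξ + c * iteratedDeriv 3 φ ξ =
          φ ξ * iteratedDeriv 3 φ ξ + 2 * deriv φ ξ * iteratedDeriv 2 φ ξ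
            - 3 * (φ ξ) ^ 2 * deriv φ ξ) := by

  set A : ℝ := (M + m) / 2 with hA
  set B : ℝ := (M - m) / 2 with hB
  have hBpos : 0 < B := by rw [hB]; linarith
  let y : ℝ → ℝ := fun t => A - B * Real.cos t
  have hym : ∀ t, m ≤ y t := fun t => by
    have := Real.cos_le_one t
    simp only [y]; nlinarith
  have hyM : ∀ t, y t ≤ M := fun t => by
    have := Real.neg_one_le_cos t
    simp only [y]; nlinarith
  have hcy : ∀ t, 0 < c - y t := fun t => by linarith [hyM t]
  have hq2 : 0 < q ^ 2 := by positivity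
  let h : ℝ → ℝ := fun t => ((y t + A) ^ 2 + q ^ 2) / (2 * (c - y t))
  have hhpos : ∀ t, 0 < h t := fun t => by
    have := hcy t
    simp only [h]; positivity
  have hysm : ContDiff ℝ (⊤ : ℕ∞) y := by
    exact contDiff_const.sub (contDiff_const.mul Real.contDiff_cos)
  have hhsm : ContDiff ℝ (⊤ : ℕ∞) h := by
    refine ContDiff.div (by fun_prop) (by fun_prop) fun t => ?_
    have := hcy t
    positivity
  have hgsm : ContDiff ℝ (⊤ : ℕ∞) (fun t => Real.sqrt (h t)) :=
    hhsm.sqrt fun t => (hhpos t).ne'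
  obtain ⟨L, θ, hL, hθ, hθd, hθL, hθs⟩ := aux_flow (fun t => Real.sqrt (h t)) hgsm
    (fun t => Real.sqrt_pos.mpr (hhpos t)) (fun t => by simp only [h, y, Real.cos_add_two_pi])
  have hP' : ∀ z : ℝ, 2 * c * z - 2 * z ^ 3 + a =
      (A - z) * ((z + A) ^ 2 + q ^ 2) + (M - z) * (z - m) * (z + A) := by
    intro z
    have h0 := hfac 0
    have h1 := hfac 1
    have h2 := hfac (-1)
    rw [hA] at *
    linear_combination 2 * z * ((h1 + h2) / 2 - h0) + (h1 - h2) / 2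
  let φ : ℝ → ℝ := fun x => y (θ x)
  have hφsm : ContDiff ℝ (⊤ : ℕ∞) φ := hysm.comp hθ
  have hyd : ∀ t, HasDerivAt y (B * Real.sin t) t := fun t => by
    have := ((Real.hasDerivAt_cos t).const_mul B).const_sub A
    have e0 : -(B * -Real.sin t) = B * Real.sin t := by ring
    rw [e0] at this
    exact this
  have hφd : ∀ x, HasDerivAt φ (B * Real.sin (θ x) * Real.sqrt (h (θ x))) x := fun x =>
    (hyd (θ x)).comp x (hθd x)
  have hφ1 : deriv φ = fun x => B * Real.sin (θ x) * Real.sqrt (h (θ x)) :=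
    funext fun x => (hφd x).deriv
  have hsq : ∀ t, B ^ 2 * Real.sin t ^ 2 = (M - y t) * (y t - m) := fun t => by
    have := Real.sin_sq_add_cos_sq t
    simp only [y, hA, hB]
    linear_combination ((M - m) / 2) ^ 2 * this
  have hss : ∀ t, Real.sqrt (h t) * Real.sqrt (h t) = h t := fun t =>
    Real.mul_self_sqrt (hhpos t).le
  have hhc : ∀ t, h t * (2 * (c - y t)) = (y t + A) ^ 2 + q ^ 2 := fun t =>
    div_mul_cancel₀ _ (by have := hcy t; positivity)
  have hE1 : ∀ x, (deriv φ x) ^ 2 * (c - φ x) = (φ x) ^ 2 * (c - (φ x) ^ 2 / 2) + a * φ x + d := by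
    intro x
    rw [hfac, hφ1]
    simp only [φ]
    linear_combination B ^ 2 * Real.sin (θ x) ^ 2 * (c - y (θ x)) * hss (θ x)
      + B ^ 2 * Real.sin (θ x) ^ 2 / 2 * hhc (θ x)
      + ((y (θ x) + A) ^ 2 + q ^ 2) / 2 * hsq (θ x)
  -- derivative of h
  have hhd : ∀ t, ∃ h', HasDerivAt h h' t ∧
      h' * (2 * (c - y t)) - h t * (2 * (B * Real.sin t)) = 2 * (y t + A) * (B * Real.sin t) := by
    intro t
    have e1 : HasDerivAt h (deriv h t) t :=
      (hhsm.differentiable (by simp) t).hasDerivAt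
    refine ⟨_, e1, ?_⟩
    have e2 := e1.mul (((hyd t).const_sub c).const_mul 2)
    have e3 := (((hyd t).add_const A).pow 2).add_const (q ^ 2)
    have e4 : (h * fun t => 2 * (c - y t)) = fun t => (y t + A) ^ 2 + q ^ 2 := funext hhc
    rw [e4] at e2
    have := e2.unique e3
    norm_num at this
    linear_combination this
  have hE2 : ∀ x, 2 * deriv (deriv φ) x * (c - φ x) - (deriv φ x) ^ 2
      = 2 * c * φ x - 2 * (φ x) ^ 3 + a := by
    intro x
    obtain ⟨h', e1, e2⟩ := hhd (θ x)
    have e3 := (e1.sqrt (hhpos _).ne').comp x (hθd x)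
    have e4 := (((Real.hasDerivAt_sin (θ x)).comp x (hθd x)).const_mul B).mul e3
    have e5 : deriv (deriv φ) x = B * Real.cos (θ x) * h (θ x) + B * Real.sin (θ x) * h' / 2 := by
      rw [hφ1]
      refine (e4.deriv).trans ?_
      have hs : Real.sqrt (h (θ x)) ≠ 0 := (Real.sqrt_pos.mpr (hhpos _)).ne'
      have := hss (θ x)
      simp only [Function.comp]
      field_simp
      linear_combination 2 * Real.cos (θ x) * this
    have hyc : B * Real.cos (θ x) = A - y (θ x) := by simp only [y]; ring
    rw [e5, hP', hφ1, hyc]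
    simp only [φ]
    linear_combination (A - y (θ x)) * hhc (θ x) + (B * Real.sin (θ x)) / 2 * e2
      - B ^ 2 * Real.sin (θ x) ^ 2 * hss (θ x) + (y (θ x) + A) * hsq (θ x)
  have hD1 : ContDiff ℝ (⊤ : ℕ∞) (deriv φ) := (contDiff_infty_iff_deriv.mp hφsm).2
  have hD2 : ContDiff ℝ (⊤ : ℕ∞) (deriv (deriv φ)) := (contDiff_infty_iff_deriv.mp hD1).2
  refine ⟨L, φ, hL, hφsm, ?_, fun x => ⟨hym _, hyM _⟩, ?_, ?_, hE1, ?_⟩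
  · intro x
    simp only [φ, y, hθL, Real.cos_add_two_pi]
  · obtain ⟨x, hx⟩ := hθs 0
    refine ⟨x, ?_⟩
    simp only [φ, y, hx, Real.cos_zero, hA, hB]; ring
  · obtain ⟨x, hx⟩ := hθs Real.pi
    refine ⟨x, ?_⟩
    simp only [φ, y, hx, Real.cos_pi, hA, hB]; ring
  · intro x
    have i3 : iteratedDeriv 3 φ = deriv (deriv (deriv φ)) := by
      simp only [iteratedDeriv_succ, iteratedDeriv_zero]
    have i2 : iteratedDeriv 2 φ = deriv (deriv φ) := by
      simp only [iteratedDeriv_succ, iteratedDeriv_zero]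
    rw [i3, i2]
    have f0 : HasDerivAt φ (deriv φ x) x := (hφsm.differentiable (by simp) x).hasDerivAt
    have f1 : HasDerivAt (deriv φ) (deriv (deriv φ) x) x :=
      (hD1.differentiable (by simp) x).hasDerivAt
    have f2 : HasDerivAt (deriv (deriv φ)) (deriv (deriv (deriv φ)) x) x :=
      (hD2.differentiable (by simp) x).hasDerivAt
    have l : HasDerivAt (fun x => 2 * deriv (deriv φ) x * (c - φ x) - (deriv φ x) ^ 2) _ x :=
      ((f2.const_mul 2).mul (f0.const_sub c)).sub (f1.pow 2)
    have r : HasDerivAt (fun x => 2 * c * φ x - 2 * (φ x) ^ 3 + a) _ x :=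
      ((f0.const_mul (2 * c)).sub ((f0.pow 3).const_mul 2)).add_const a
    rw [funext hE2] at l
    have := l.unique r
    norm_num at this
    linear_combination this / 2
end

section
/- Let c, a, d, m, q ∈ ℝ with q ≠ 0 and m < c, and suppose that for every y ∈ ℝ: y²·(c − y²/2) + a·y + d = (1/2)·(c − y)·(y − m)·((y + (m+c)/2)² + q²). Then there exist L > 0 and a continuous function φ : ℝ → ℝ, periodic with period L, such that: m ≤ φ(ξ) ≤ c for all ξ; φ(0) = c; φ attains the value m; φ is C^∞ on ℝ ∖ {kL : k ∈ ℤ}; for every ξ ∉ {kL : k ∈ ℤ}, φ is differentiable at ξ with (φ'(ξ))² = (1/2)·(φ(ξ) − m)·((φ(ξ) + (m+c)/2)² + q²); and the one-sided limits of φ' at 0 exist, are finite, and equal ∓√((1/2)·(c − m)·(((3c+m)/2)² + q²)) from the right and left respectively (so φ has a peak at each point of LZ). -/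
open Filter Topology

theorem aux_ode (s : ℝ) (hs : 0 < s) (g : ℝ → ℝ) (hg : ContDiff ℝ (⊤ : ℕ∞) g)
    (hpos : ∀ w, 0 < g w) :
    ∃ (L : ℝ) (W : ℝ → ℝ), 0 < L ∧
      (∀ x ∈ Set.Icc 0 L, ContDiffAt ℝ (⊤ : ℕ∞) W x ∧ HasDerivAt W (g (W x)) x ∧
        -s ≤ W x ∧ W x ≤ s) ∧ W 0 = -s ∧ W L = s ∧ ∃ x ∈ Set.Ico 0 L, W x = 0 := by
  have hinv : ContDiff ℝ (⊤ : ℕ∞) (fun w => (g w)⁻¹) := hg.inv (fun w => (hpos w).ne')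
  set G : ℝ → ℝ := fun w => ∫ t in (-s)..w, (g t)⁻¹ with hG
  have hd : ∀ w, HasDerivAt G (g w)⁻¹ w := fun w =>
    intervalIntegral.integral_hasDerivAt_right (hinv.continuous.intervalIntegrable _ _)
      hinv.continuous.aestronglyMeasurable.stronglyMeasurableAtFilter hinv.continuous.continuousAt
  have hder : deriv G = fun w => (g w)⁻¹ := funext fun w => (hd w).deriv
  have hGs : ContDiff ℝ (⊤ : ℕ∞) G := by
    rw [contDiff_infty_iff_deriv]
    exact ⟨fun w => (hd w).differentiableAt, by rw [hder]; exact hinv⟩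
  have hmono : StrictMono G := strictMono_of_deriv_pos (fun w => by
    rw [hder]; exact inv_pos.2 (hpos w))
  have hopen : IsOpenMap G := by
    refine isOpenMap_of_hasStrictDerivAt (f' := fun w => (g w)⁻¹) (fun w => ?_)
      (fun w => (inv_pos.2 (hpos w)).ne')
    exact hGs.contDiffAt.hasStrictDerivAt' (hd w) (by simp)
  have hemb : IsOpenEmbedding G := .of_continuous_injective_isOpenMap hGs.continuous
    hmono.injective hopen
  let e := hemb.toOpenPartialHomeomorph G
  have heG : ∀ w, e w = G w := fun w => rfl
  have hl : ∀ w, e.symm (G w) = w := fun w => e.left_inv (x := w) (by simp [e])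
  have h0 : G (-s) = 0 := by simp [hG]
  refine ⟨G s, e.symm, ?_, ?_, ?_, hl s, G 0, ?_, hl 0⟩
  · rw [← h0]; exact hmono (by linarith)
  · intro x hx
    obtain ⟨w, hw, rfl⟩ : ∃ w ∈ Set.Icc (-s) s, G w = x := by
      have := intermediate_value_Icc (by linarith : -s ≤ s) hGs.continuous.continuousOn
      rw [h0] at this
      exact this hx
    have ht : G w ∈ e.target := by simp [e]
    have hd' : HasDerivAt e (g w)⁻¹ (e.symm (G w)) := by rw [hl]; exact hd w
    refine ⟨e.contDiffAt_symm_deriv (inv_pos.2 (hpos w)).ne' ht hd' hGs.contDiffAt, ?_, ?_, ?_⟩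
    · have := e.hasDerivAt_symm ht (inv_pos.2 (hpos w)).ne' hd'
      rw [hl]
      simpa using this
    · rw [hl]; exact hw.1
    · rw [hl]; exact hw.2
  · have := hl (-s); rwa [h0] at this
  · exact ⟨by rw [← h0]; exact hmono.monotone (by linarith), hmono hs⟩

theorem aux_periodic (L : ℝ) (hL : 0 < L) (f : ℝ → ℝ) (hf : ContinuousOn f (Set.Icc 0 L))
    (h0 : f 0 = f L) :
    ∃ φ : ℝ → ℝ, Continuous φ ∧ Function.Periodic φ L ∧
      (∀ (k : ℤ) (x : ℝ), x - k * L ∈ Set.Icc 0 L → φ x = f (x - k * L)) ∧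
      (∀ x, ∃ k : ℤ, x - k * L ∈ Set.Ico 0 L) := by
  have hk : ∀ x, ∃ k : ℤ, x - k * L ∈ Set.Ico 0 L := fun x => by
    refine ⟨⌊x / L⌋, ?_, ?_⟩
    · have := Int.floor_le (x / L)
      rw [le_div_iff₀ hL] at this; linarith
    · have := Int.lt_floor_add_one (x / L)
      rw [div_lt_iff₀ hL] at this; linarith
  have key : ∀ (k : ℤ) (x : ℝ), x - k * L ∈ Set.Ico 0 L →
      f (L * Int.fract (x / L)) = f (x - k * L) := fun k x hx => by
    have : ⌊x / L⌋ = k := by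
      rw [Int.floor_eq_iff, le_div_iff₀ hL, div_lt_iff₀ hL]
      exact ⟨by linarith [hx.1], by linarith [hx.2]⟩
    rw [← Int.self_sub_floor, this]
    congr 1; field_simp
  refine ⟨fun x => f (L * Int.fract (x / L)), ?_, ?_, ?_, hk⟩
  · have : ContinuousOn (fun y => f (L * y)) (Set.Icc 0 1) :=
      hf.comp (by fun_prop) (fun y hy => ⟨mul_nonneg hL.le hy.1, by nlinarith [hy.2]⟩)
    exact (this.comp_fract'' (by simpa using h0)).comp (continuous_id.div_const L)
  · intro x
    simp only [add_div, div_self hL.ne', Int.fract_add_one]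
  · intro k x hx
    rcases hx.2.lt_or_eq with h | h
    · exact key k x ⟨hx.1, h⟩
    · have h1 : x - ((k + 1 : ℤ) : ℝ) * L = 0 := by push_cast; linarith
      show f _ = _
      rw [key (k + 1) x (by rw [h1]; exact ⟨le_rfl, hL⟩), h1, h, h0]

/-- Periodic peakons of the mCH equation in the case `m < M = c` of two simple real zeros
of the quartic `P(y) = y²(c - y²/2) + ay + d`: the factor `c - φ` cancels and the profile
reaches `φ = c` with finite nonzero one-sided slopes `∓√((1/2)(c-m)(((3c+m)/2)² + q²))`. -/
theorem mCH_periodic_peakons (c a d m q : ℝ) (hq : q ≠ 0) (hmc : m < c)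
    (hfac : ∀ y : ℝ,
      y ^ 2 * (c - y ^ 2 / 2) + a * y + d =
        (1 / 2) * (c - y) * (y - m) * ((y + (m + c) / 2) ^ 2 + q ^ 2)) :
    ∃ (L : ℝ) (φ : ℝ → ℝ), 0 < L ∧
      Continuous φ ∧
      Function.Periodic φ L ∧
      (∀ ξ : ℝ, m ≤ φ ξ ∧ φ ξ ≤ c) ∧
      φ 0 = c ∧
      (∃ ξ : ℝ, φ ξ = m) ∧
      ContDiffOn ℝ (⊤ : ℕ∞) φ {ξ : ℝ | ∀ k : ℤ, ξ ≠ (k : ℝ) * L} ∧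
      (∀ ξ : ℝ, (∀ k : ℤ, ξ ≠ (k : ℝ) * L) →
        DifferentiableAt ℝ φ ξ ∧
        (deriv φ ξ) ^ 2 =
          (1 / 2) * (φ ξ - m) * ((φ ξ + (m + c) / 2) ^ 2 + q ^ 2)) ∧
      Tendsto (deriv φ) (nhdsWithin 0 (Set.Ioi 0))
        (nhds (-Real.sqrt ((1 / 2) * (c - m) * (((3 * c + m) / 2) ^ 2 + q ^ 2)))) ∧
      Tendsto (deriv φ) (nhdsWithin 0 (Set.Iio 0))
        (nhds (Real.sqrt ((1 / 2) * (c - m) * (((3 * c + m) / 2) ^ 2 + q ^ 2)))) := by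
  have hcm : 0 < c - m := sub_pos.2 hmc
  set s := Real.sqrt (c - m) with hsdef
  have hs : 0 < s := Real.sqrt_pos.2 hcm
  have hs2 : s ^ 2 = c - m := Real.sq_sqrt hcm.le
  have hQ : ∀ w : ℝ, 0 < ((m + w ^ 2 + (m + c) / 2) ^ 2 + q ^ 2) / 8 := fun w => by positivity
  set g : ℝ → ℝ := fun w => Real.sqrt (((m + w ^ 2 + (m + c) / 2) ^ 2 + q ^ 2) / 8) with hgdef
  have hg : ContDiff ℝ (⊤ : ℕ∞) g := ContDiff.sqrt (by fun_prop) (fun w => (hQ w).ne')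
  have hg2 : ∀ w, g w ^ 2 = ((m + w ^ 2 + (m + c) / 2) ^ 2 + q ^ 2) / 8 := fun w =>
    Real.sq_sqrt (hQ w).le
  obtain ⟨L, W, hL, hW, hW0, hWL, x₀, hx₀, hWx₀⟩ :=
    aux_ode s hs g hg (fun w => Real.sqrt_pos.2 (hQ w))
  have hWc : ContinuousOn W (Set.Icc 0 L) := fun x hx => (hW x hx).1.continuousAt.continuousWithinAt
  obtain ⟨φ, hφc, hφp, hφ, hk⟩ := aux_periodic L hL (fun x => m + W x ^ 2)
    (by fun_prop) (by simp [hW0, hWL])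
  have hk' : ∀ x, (∀ k : ℤ, x ≠ (k : ℝ) * L) → ∃ k : ℤ, x - k * L ∈ Set.Ioo 0 L := fun x hx => by
    obtain ⟨k, h1, h2⟩ := hk x
    exact ⟨k, lt_of_le_of_ne h1 (fun h => hx k (by linarith)), h2⟩
  have hloc : ∀ (k : ℤ) (x : ℝ), x - k * L ∈ Set.Ioo 0 L →
      φ =ᶠ[𝓝 x] fun y => m + W (y - k * L) ^ 2 := fun k x hx => by
    have : ∀ᶠ y in 𝓝 x, y - k * L ∈ Set.Ioo 0 L :=
      (by fun_prop : Continuous fun y : ℝ => y - k * L).continuousAt.eventually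
        (isOpen_Ioo.mem_nhds hx)
    filter_upwards [this] with y hy using hφ k y (Set.Ioo_subset_Icc_self hy)
  have hder : ∀ (k : ℤ) (x : ℝ), x - k * L ∈ Set.Ioo 0 L →
      HasDerivAt φ (2 * W (x - k * L) * g (W (x - k * L))) x := fun k x hx => by
    refine HasDerivAt.congr_of_eventuallyEq ?_ (hloc k x hx)
    have h1 := (hW _ (Set.Ioo_subset_Icc_self hx)).2.1
    have h2 := ((h1.comp_sub_const x (k * L)).pow 2).const_add m
    convert h2 using 1 <;> simp
  have hval : Real.sqrt ((1 / 2) * (c - m) * (((3 * c + m) / 2) ^ 2 + q ^ 2)) = 2 * s * g s := by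
    rw [Real.sqrt_eq_iff_mul_self_eq (by positivity) (by positivity)]
    have := hg2 s
    have h : m + s ^ 2 = c := by linarith
    rw [h] at this
    symm
    calc 2 * s * g s * (2 * s * g s) = 4 * s ^ 2 * g s ^ 2 := by ring
      _ = _ := by rw [this, hs2]; ring
  have hgs : g (-s) = g s := by simp [hgdef]
  refine ⟨L, φ, hL, hφc, hφp, ?_, ?_, ?_, ?_, ?_, ?_, ?_⟩
  · intro x
    obtain ⟨k, hx⟩ := hk x
    have hx' := Set.Ico_subset_Icc_self hx
    rw [hφ k x hx']
    obtain ⟨-, -, h1, h2⟩ := hW _ hx'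
    constructor
    · nlinarith [sq_nonneg (W (x - k * L))]
    · nlinarith
  · have := hφ 0 0 (by simp [hL.le])
    simp [hW0] at this
    rw [this]; linarith
  · refine ⟨x₀, ?_⟩
    have := hφ 0 x₀ (by simpa using Set.Ico_subset_Icc_self hx₀)
    simpa [hWx₀] using this
  · intro x hx
    obtain ⟨k, hx⟩ := hk' x hx
    refine ContDiffAt.contDiffWithinAt (ContDiffAt.congr_of_eventuallyEq ?_ (hloc k x hx))
    have h1 := (hW _ (Set.Ioo_subset_Icc_self hx)).1
    have h2 : ContDiffAt ℝ (⊤ : ℕ∞) (fun y => W (y - k * L)) x :=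
      ContDiffAt.comp x h1 (by fun_prop)
    exact contDiffAt_const.add (h2.pow 2)
  · intro x hx
    obtain ⟨k, hx⟩ := hk' x hx
    have h := hder k x hx
    refine ⟨h.differentiableAt, ?_⟩
    rw [h.deriv, hφ k x (Set.Ioo_subset_Icc_self hx), mul_pow, hg2]
    ring
  · rw [hval]
    have hc : ContinuousAt (fun x => 2 * W x * g (W x)) 0 := by
      have h1 := (hW 0 ⟨le_rfl, hL.le⟩).1.continuousAt
      exact (continuousAt_const.mul h1).mul (hg.continuous.continuousAt.comp h1)
    have ht := hc.tendsto.mono_left (nhdsWithin_le_nhds (s := Set.Ioi 0))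
    simp only [hW0, hgs] at ht
    rw [show -(2 * s * g s) = 2 * -s * g s by ring]
    refine ht.congr' ?_
    filter_upwards [Ioo_mem_nhdsGT hL] with x hx
    have := (hder 0 x (by simpa using hx)).deriv
    simpa using this.symm
  · rw [hval]
    have hc : ContinuousAt (fun x => 2 * W (x + L) * g (W (x + L))) 0 := by
      have h1 : ContinuousAt (fun x => W (x + L)) 0 :=
        ContinuousAt.comp' (by simpa using (hW L ⟨hL.le, le_rfl⟩).1.continuousAt) (by fun_prop)
      exact (continuousAt_const.mul h1).mul (hg.continuous.continuousAt.comp h1)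
    have ht := hc.tendsto.mono_left (nhdsWithin_le_nhds (s := Set.Iio 0))
    simp only [zero_add, hWL] at ht
    refine ht.congr' ?_
    filter_upwards [Ioo_mem_nhdsLT (neg_lt_zero.2 hL)] with x hx
    have := (hder (-1) x (by
      push_cast; exact ⟨by linarith [hx.1], by linarith [hx.2]⟩)).deriv
    rw [this]
    have e : x - ((-1 : ℤ) : ℝ) * L = x + L := by push_cast; ring
    rw [e]
end

section
/- Let c, a, d, m, M, q ∈ ℝ with q ≠ 0 and m < c < M, and suppose that for every y ∈ ℝ: y²·(c − y²/2) + a·y + d = (1/2)·(M − y)·(y − m)·((y + (M+m)/2)² + q²). Then there exist L > 0 and a continuous function φ : ℝ → ℝ, periodic with period L, such that: m ≤ φ(ξ) ≤ c for all ξ; φ(0) = c; φ attains the value m; φ is C^∞ on ℝ ∖ {kL : k ∈ ℤ}; for every ξ ∉ {kL : k ∈ ℤ}, φ is differentiable at ξ with (φ'(ξ))²·(c − φ(ξ)) = φ(ξ)²·(c − φ(ξ)²/2) + a·φ(ξ) + d; and |φ'(ξ)| → ∞ as ξ → 0 with ξ ≠ 0 (φ has a cusp at each point of LZ). -/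
open Filter Topology

/-- Periodic cuspons of the mCH equation in the case `m < c < M` of two simple real zeros
of the quartic `P(y) = y²(c - y²/2) + ay + d`: the profile has maximum `c` and the slope
blows up at the crests (a cusp). -/
theorem mCH_periodic_cuspons (c a d m M q : ℝ) (hq : q ≠ 0) (hmc : m < c) (hcM : c < M)
    (hfac : ∀ y : ℝ,
      y ^ 2 * (c - y ^ 2 / 2) + a * y + d =
        (1 / 2) * (M - y) * (y - m) * ((y + (M + m) / 2) ^ 2 + q ^ 2)) :
    ∃ (L : ℝ) (φ : ℝ → ℝ), 0 < L ∧
      Continuous φ ∧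
      Function.Periodic φ L ∧
      (∀ ξ : ℝ, m ≤ φ ξ ∧ φ ξ ≤ c) ∧
      φ 0 = c ∧
      (∃ ξ : ℝ, φ ξ = m) ∧
      ContDiffOn ℝ (⊤ : ℕ∞) φ {ξ : ℝ | ∀ k : ℤ, ξ ≠ (k : ℝ) * L} ∧
      (∀ ξ : ℝ, (∀ k : ℤ, ξ ≠ (k : ℝ) * L) →
        DifferentiableAt ℝ φ ξ ∧
        (deriv φ ξ) ^ 2 * (c - φ ξ) =
          (φ ξ) ^ 2 * (c - (φ ξ) ^ 2 / 2) + a * φ ξ + d) ∧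
      Tendsto (fun ξ => |deriv φ ξ|) (nhdsWithin 0 {(0 : ℝ)}ᶜ) atTop := by
  set D := c - m with hD
  have hDpos : 0 < D := by rw [hD]; linarith
  set G : ℝ → ℝ := fun y => (1 / 2) * (M - y) * ((y + (M + m) / 2) ^ 2 + q ^ 2) with hG
  set Y : ℝ → ℝ := fun θ => c - D * Real.sin θ ^ 2 with hY
  have hYc : ∀ θ, Y θ ≤ c := fun θ => by
    have := mul_nonneg hDpos.le (sq_nonneg (Real.sin θ))
    simp only [hY]; linarith
  have hYm : ∀ θ, m ≤ Y θ := fun θ => by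
    have := mul_le_mul_of_nonneg_left (Real.sin_sq_le_one θ) hDpos.le
    simp only [hY]; linarith
  have hGpos : ∀ θ, 0 < G (Y θ) := fun θ => by
    have h1 : 0 < M - Y θ := by linarith [hYc θ]
    have h2 : 0 < q ^ 2 := by positivity
    simp only [hG]; positivity
  have hYs : ContDiff ℝ (⊤ : ℕ∞) Y := by
    simp only [hY]
    exact contDiff_const.sub (contDiff_const.mul (Real.contDiff_sin.pow 2))
  have hGs : ContDiff ℝ (⊤ : ℕ∞) (fun θ => G (Y θ)) := by
    simp only [hG]; fun_prop
  have hRs : ContDiff ℝ (⊤ : ℕ∞) (fun θ => Real.sqrt (G (Y θ))) :=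
    hGs.sqrt (fun θ => (hGpos θ).ne')
  have hRpos : ∀ θ, 0 < Real.sqrt (G (Y θ)) := fun θ => Real.sqrt_pos.2 (hGpos θ)
  set w : ℝ → ℝ := fun θ => 2 * D * Real.sin θ ^ 2 / Real.sqrt (G (Y θ)) with hw
  have hws : ContDiff ℝ (⊤ : ℕ∞) w := by
    simp only [hw]
    exact (contDiff_const.mul (Real.contDiff_sin.pow 2)).div hRs (fun θ => (hRpos θ).ne')
  have hw0 : ∀ θ, 0 ≤ w θ := fun θ => by
    have := hRpos θ
    simp only [hw]; positivity
  have hwpos : ∀ θ, Real.sin θ ≠ 0 → 0 < w θ := fun θ h => by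
    have := hRpos θ
    simp only [hw]; positivity
  have hYper : Function.Periodic Y Real.pi := fun θ => by
    simp only [hY, Real.sin_add_pi, neg_sq]
  have hwper : Function.Periodic w Real.pi := fun θ => by
    simp only [hw, hYper θ, Real.sin_add_pi, neg_sq]
  have hwi : ∀ t₁ t₂, IntervalIntegrable w MeasureTheory.volume t₁ t₂ :=
    fun t₁ t₂ => hws.continuous.intervalIntegrable _ _
  set T : ℝ → ℝ := fun θ => ∫ t in (0:ℝ)..θ, w t with hT
  have hTd : ∀ θ, HasDerivAt T (w θ) θ := fun θ =>
    hws.continuous.integral_hasStrictDerivAt 0 θ |>.hasDerivAt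
  have hTs : ContDiff ℝ (⊤ : ℕ∞) T := by
    refine contDiff_infty_iff_deriv.2 ⟨fun θ => (hTd θ).differentiableAt, ?_⟩
    rwa [show deriv T = w from funext fun θ => (hTd θ).deriv]
  have hTmono : StrictMono T := by
    intro x y hxy
    have : 0 < ∫ t in x..y, w t := by
      refine intervalIntegral.integral_pos hxy hws.continuous.continuousOn (fun t _ => hw0 t) ?_
      by_cases hx : Real.sin x = 0
      · have he0 : 0 < min (y - x) 1 := lt_min (by linarith) one_pos
        have he1 : min (y - x) 1 ≤ y - x := min_le_left _ _
        have he2 : min (y - x) 1 ≤ 1 := min_le_right _ _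
        refine ⟨x + min (y - x) 1, ⟨by linarith, by linarith⟩, hwpos _ ?_⟩
        have hs : 0 < Real.sin (min (y - x) 1) :=
          Real.sin_pos_of_pos_of_lt_pi he0 (by linarith [Real.pi_gt_three])
        rw [Real.sin_add, hx, zero_mul, zero_add]
        refine mul_ne_zero (fun hc => ?_) hs.ne'
        have := Real.sin_sq_add_cos_sq x
        rw [hx, hc] at this
        norm_num at this
      · exact ⟨x, ⟨le_rfl, hxy.le⟩, hwpos x hx⟩
    have h2 := intervalIntegral.integral_add_adjacent_intervals (hwi 0 x) (hwi x y)
    simp only [hT]; linarith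
  have hT0 : T 0 = 0 := by simp [hT]
  set L := T Real.pi with hL
  have hLpos : 0 < L := by rw [← hT0]; exact hTmono Real.pi_pos
  have hTadd : ∀ θ, T (θ + Real.pi) = T θ + L := fun θ => by
    have h1 := hwper.intervalIntegral_add_eq θ 0
    have h2 := intervalIntegral.integral_add_adjacent_intervals (hwi 0 θ) (hwi θ (θ + Real.pi))
    rw [zero_add] at h1
    simp only [hL, hT]; linarith
  have hTk : ∀ k : ℤ, T (k * Real.pi) = k * L := fun k => by
    have h1 := hwper.intervalIntegral_add_zsmul_eq k 0 hwi
    simpa [hT, hL] using h1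
  have hsurj : Function.Surjective T :=
    hTs.continuous.surjective
      (hwper.tendsto_atTop_intervalIntegral_of_pos hLpos Real.pi_pos)
      (hwper.tendsto_atBot_intervalIntegral_of_pos hLpos Real.pi_pos)
  let e : ℝ ≃ₜ ℝ := (hTmono.orderIsoOfSurjective T hsurj).toHomeomorph
  have he : ∀ θ, e θ = T θ := fun θ => rfl
  have heT : ∀ ξ, T (e.symm ξ) = ξ := fun ξ => e.apply_symm_apply ξ
  have hTe : ∀ θ, e.symm (T θ) = θ := fun θ => e.symm_apply_apply θ
  have hsin : ∀ ξ : ℝ, (∀ k : ℤ, ξ ≠ (k : ℝ) * L) → Real.sin (e.symm ξ) ≠ 0 := by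
    intro ξ hξ h
    obtain ⟨k, hk⟩ := Real.sin_eq_zero_iff.1 h
    exact hξ k (by rw [← hTk k, hk, heT])
  have hed : ∀ ξ, Real.sin (e.symm ξ) ≠ 0 →
      HasDerivAt e.symm (w (e.symm ξ))⁻¹ ξ := fun ξ h =>
    HasDerivAt.of_local_left_inverse e.symm.continuous.continuousAt (hTd _) (hwpos _ h).ne'
      (Eventually.of_forall heT)
  have hes : ∀ ξ, Real.sin (e.symm ξ) ≠ 0 → ContDiffAt ℝ (⊤ : ℕ∞) e.symm ξ := fun ξ h =>
    e.toOpenPartialHomeomorph.contDiffAt_symm_deriv (f₀' := w (e.symm ξ)) (hwpos _ h).ne'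
      (by simp) (hTd _) hTs.contDiffAt
  have hYd : ∀ θ, HasDerivAt Y (-(D * (2 * Real.sin θ * Real.cos θ))) θ := fun θ => by
    have := (((Real.hasDerivAt_sin θ).pow 2).const_mul D).const_sub c
    simpa using this
  have hφd : ∀ ξ, Real.sin (e.symm ξ) ≠ 0 →
      HasDerivAt (fun ξ => Y (e.symm ξ))
        (-(Real.cos (e.symm ξ) * Real.sqrt (G (Y (e.symm ξ))) / Real.sin (e.symm ξ))) ξ := by
    intro ξ h
    have h1 := (hYd (e.symm ξ)).comp ξ (hed ξ h)
    refine h1.congr_deriv ?_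
    have hR := (hRpos (e.symm ξ)).ne'
    simp only [hw]
    field_simp
  have he0 : e.symm 0 = 0 := by simpa only [hT0] using hTe 0
  refine ⟨L, fun ξ => Y (e.symm ξ), hLpos, hYs.continuous.comp e.symm.continuous, ?_,
    fun ξ => ⟨hYm _, hYc _⟩, ?_, ⟨T (Real.pi / 2), ?_⟩, ?_, ?_, ?_⟩
  · intro ξ
    have : e.symm (ξ + L) = e.symm ξ + Real.pi := by
      rw [← hTe (e.symm ξ + Real.pi), hTadd, heT]
    simp only [this, hYper _]
  · simp [he0, hY]
  · simp [hTe, hY, hD]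
  · intro ξ hξ
    exact (hYs.contDiffAt.comp ξ (hes ξ (hsin ξ hξ))).contDiffWithinAt
  · intro ξ hξ
    have h := hsin ξ hξ
    refine ⟨(hφd ξ h).differentiableAt, ?_⟩
    rw [(hφd ξ h).deriv, hfac]
    have hsq := Real.sq_sqrt (hGpos (e.symm ξ)).le
    have hcs := Real.cos_sq' (e.symm ξ)
    have e1 : c - Y (e.symm ξ) = D * Real.sin (e.symm ξ) ^ 2 := by simp only [hY]; ring
    have e2 : Y (e.symm ξ) - m = D * Real.cos (e.symm ξ) ^ 2 := by
      rw [hcs]; simp only [hY, hD]; ring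
    rw [e1, e2, neg_sq, div_pow, mul_pow, hsq]
    simp only [hG]
    field_simp
  · have hev : ∀ᶠ ξ in nhdsWithin 0 {(0 : ℝ)}ᶜ, Real.sin (e.symm ξ) ≠ 0 := by
      have hn : ∀ᶠ ξ in nhds (0:ℝ), e.symm ξ ∈ Set.Ioo (-Real.pi) Real.pi := by
        refine e.symm.continuous.continuousAt.eventually_mem ?_
        rw [he0]
        exact Ioo_mem_nhds (by linarith [Real.pi_pos]) Real.pi_pos
      filter_upwards [nhdsWithin_le_nhds hn, self_mem_nhdsWithin] with ξ h1 h2 h3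
      rw [Real.sin_eq_zero_iff_of_lt_of_lt h1.1 h1.2] at h3
      apply h2
      rw [Set.mem_singleton_iff, ← heT ξ, h3, hT0]
    have hsc : Continuous fun ξ => |Real.sin (e.symm ξ)| :=
      (Real.continuous_sin.comp e.symm.continuous).abs
    have hnum : Continuous fun ξ => |Real.cos (e.symm ξ)| * Real.sqrt (G (Y (e.symm ξ))) :=
      ((Real.continuous_cos.comp e.symm.continuous).abs).mul
        (hRs.continuous.comp e.symm.continuous)
    have t1 : Tendsto (fun ξ => |Real.sin (e.symm ξ)|) (nhdsWithin 0 {(0 : ℝ)}ᶜ)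
        (nhdsWithin 0 (Set.Ioi 0)) := by
      refine tendsto_nhdsWithin_iff.2 ⟨?_, hev.mono fun ξ h => abs_pos.2 h⟩
      have := (hsc.tendsto 0).mono_left (nhdsWithin_le_nhds (s := {(0 : ℝ)}ᶜ))
      simpa [he0] using this
    have t2 := (hnum.tendsto 0).mono_left (nhdsWithin_le_nhds (s := {(0 : ℝ)}ᶜ))
    have t3 := t2.pos_mul_atTop (by rw [he0]; simpa using hRpos 0)
      (tendsto_inv_nhdsGT_zero.comp t1)
    refine t3.congr' ?_
    filter_upwards [hev] with ξ h
    rw [(hφd ξ h).deriv, abs_neg, abs_div, abs_mul, abs_of_pos (hRpos _)]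
    rfl
end

section
/- Let c, a, d, m, M, z ∈ ℝ with z < m < M < c, and suppose that for every y ∈ ℝ: y²·(c − y²/2) + a·y + d = (1/2)·(M − y)·(y − m)²·(y − z). Then there exists a C^∞ function φ : ℝ → ℝ such that: m < φ(ξ) ≤ M for all ξ; φ(0) = M and M is the maximum of φ; φ(ξ) → m as ξ → +∞ and as ξ → −∞; and (φ'(ξ))²·(c − φ(ξ)) = φ(ξ)²·(c − φ(ξ)²/2) + a·φ(ξ) + d for all ξ ∈ ℝ. -/
open Filter Topology

/-- Inverse of a primitive of a smooth function bounded below by a positive constant. -/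
lemma exists_smooth_time_change (g : ℝ → ℝ) (hg : ContDiff ℝ (⊤ : ℕ∞) g) (ε : ℝ) (hε : 0 < ε)
    (hb : ∀ x, ε ≤ g x) :
    ∃ t : ℝ → ℝ, ContDiff ℝ (⊤ : ℕ∞) t ∧ t 0 = 0 ∧ (∀ x, HasDerivAt t (g (t x))⁻¹ x) ∧
      Tendsto t atTop atTop ∧ Tendsto t atBot atBot := by
  set T : ℝ → ℝ := fun x => ∫ y in (0 : ℝ)..x, g y with hT
  have hd : ∀ x, HasDerivAt T (g x) x := fun x =>
    hg.continuous.integral_hasStrictDerivAt 0 x |>.hasDerivAt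
  have hgpos : ∀ x, 0 < g x := fun x => hε.trans_le (hb x)
  have hT0 : T 0 = 0 := by simp [hT]
  have hderiv : deriv T = g := funext fun x => (hd x).deriv
  have hTdiff : Differentiable ℝ T := fun x => (hd x).differentiableAt
  have hTs : ContDiff ℝ (⊤ : ℕ∞) T := by
    rw [contDiff_infty_iff_deriv]
    exact ⟨hTdiff, by rw [hderiv]; exact hg⟩
  have hmono : StrictMono T := strictMono_of_deriv_pos (by rw [hderiv]; exact hgpos)
  have hmono2 : Monotone (fun x => T x - ε * x) := by
    have h2 : ∀ x, HasDerivAt (fun x => T x - ε * x) (g x - ε) x := fun x => by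
      simpa using (hd x).fun_sub ((hasDerivAt_id x).const_mul ε)
    refine monotone_of_deriv_nonneg (fun x => (h2 x).differentiableAt) fun x => ?_
    rw [(h2 x).deriv]; linarith [hb x]
  have htop : Tendsto T atTop atTop := by
    refine tendsto_atTop_mono' _ ?_ (tendsto_id.const_mul_atTop hε)
    filter_upwards [eventually_ge_atTop 0] with x hx
    have := hmono2 hx
    simp only [hT0, id] at *
    linarith
  have hbot : Tendsto T atBot atBot := by
    refine tendsto_atBot_mono' _ ?_ (tendsto_id.const_mul_atBot hε)
    filter_upwards [eventually_le_atBot 0] with x hx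
    have := hmono2 hx
    simp only [hT0, id] at *
    linarith
  have hsurj : Function.Surjective T := hTdiff.continuous.surjective htop hbot
  let e : ℝ ≃o ℝ := hmono.orderIsoOfSurjective T hsurj
  have he : ∀ x, e x = T x := fun x => rfl
  have heT : (e.toHomeomorph : ℝ → ℝ) = T := rfl
  refine ⟨e.symm, ?_, ?_, ?_, e.symm.tendsto_atTop, e.symm.tendsto_atBot⟩
  · exact e.toHomeomorph.contDiff_symm_deriv (f' := g) (fun x => (hgpos x).ne') hd hTs
  · rw [OrderIso.symm_apply_eq, he, hT0]
  · intro x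
    exact HasDerivAt.of_local_left_inverse e.symm.continuous.continuousAt (hd _)
      (hgpos _).ne' (Eventually.of_forall fun y => e.apply_symm_apply y)

/-- Smooth solitary traveling waves with decay for the mCH equation in the case
`z < m < M < c` where the quartic `P(y) = y²(c - y²/2) + ay + d` has a double zero at `m`,
a simple zero at `M` and a further real zero `z`. -/
theorem mCH_smooth_wave_with_decay (c a d m M z : ℝ)
    (hzm : z < m) (hmM : m < M) (hMc : M < c)
    (hfac : ∀ y : ℝ,
      y ^ 2 * (c - y ^ 2 / 2) + a * y + d =
        (1 / 2) * (M - y) * (y - m) ^ 2 * (y - z)) :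
    ∃ φ : ℝ → ℝ,
      ContDiff ℝ (⊤ : ℕ∞) φ ∧
      (∀ ξ : ℝ, m < φ ξ ∧ φ ξ ≤ M) ∧
      φ 0 = M ∧ (∀ ξ : ℝ, φ ξ ≤ φ 0) ∧
      Tendsto φ atTop (nhds m) ∧ Tendsto φ atBot (nhds m) ∧
      (∀ ξ : ℝ,
        (deriv φ ξ) ^ 2 * (c - φ ξ) =
          (φ ξ) ^ 2 * (c - (φ ξ) ^ 2 / 2) + a * φ ξ + d) := by
  set ψ : ℝ → ℝ := fun t => m + (M - m) / Real.cosh t ^ 2 with hψ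
  have hc : ∀ t, 0 < Real.cosh t := Real.cosh_pos
  have hψs : ContDiff ℝ (⊤ : ℕ∞) ψ :=
    contDiff_const.add (contDiff_const.div (Real.contDiff_cosh.pow 2)
      fun t => (pow_pos (hc t) 2).ne')
  have hψm : ∀ t, m < ψ t := fun t => by
    have : 0 < (M - m) / Real.cosh t ^ 2 := div_pos (by linarith) (pow_pos (hc t) 2)
    simp only [hψ]; linarith
  have hψM : ∀ t, ψ t ≤ M := fun t => by
    have : (M - m) / Real.cosh t ^ 2 ≤ M - m :=
      div_le_self (by linarith) (one_le_pow₀ (Real.one_le_cosh t))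
    simp only [hψ]; linarith
  have hψ0 : ψ 0 = M := by simp [hψ]
  have hcosh : Tendsto Real.cosh atTop atTop := by
    refine tendsto_atTop_mono (f := fun x => Real.exp x / 2) (fun x => ?_)
      (Real.tendsto_exp_atTop.atTop_div_const (by norm_num))
    rw [Real.cosh_eq]; linarith [Real.exp_pos (-x)]
  have hψtop : Tendsto ψ atTop (𝓝 m) := by
    have h1 : Tendsto (fun t => Real.cosh t ^ 2) atTop atTop :=
      (tendsto_pow_atTop two_ne_zero).comp hcosh
    simpa [hψ] using (h1.const_div_atTop (M - m)).const_add m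
  have hψbot : Tendsto ψ atBot (𝓝 m) := by
    have h1 := hψtop.comp tendsto_neg_atBot_atTop
    have h2 : ψ ∘ Neg.neg = ψ := by funext t; simp [hψ]
    rwa [show (ψ ∘ fun x => -x) = ψ from h2] at h1
  have hψd : ∀ t, HasDerivAt ψ (-(2 * (M - m) * Real.sinh t / Real.cosh t ^ 3)) t := fun t => by
    have h := (((Real.hasDerivAt_cosh t).pow 2).fun_inv
      (pow_pos (hc t) 2).ne').const_mul (M - m) |>.const_add m
    have := (hc t).ne'
    refine HasDerivAt.congr_deriv (f := ψ) h ?_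
    simp only [Pi.pow_apply]
    field_simp
    norm_num
    ring
  set q : ℝ → ℝ := fun t => 8 * (c - ψ t) / ((M - m) * (ψ t - z)) with hq
  have hden : ∀ t, 0 < (M - m) * (ψ t - z) := fun t =>
    mul_pos (by linarith) (by linarith [hψm t])
  have hqpos : ∀ t, 0 < q t := fun t => div_pos (by linarith [hψM t]) (hden t)
  have hqs : ContDiff ℝ (⊤ : ℕ∞) q :=
    (contDiff_const.mul (contDiff_const.sub hψs)).div
      (contDiff_const.mul (hψs.sub contDiff_const)) fun t => (hden t).ne'
  have hε0 : 0 < 8 * (c - M) / ((M - m) * (M - z)) :=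
    div_pos (by linarith) (mul_pos (by linarith) (by linarith))
  obtain ⟨t, hts, ht0, htd, httop, htbot⟩ := exists_smooth_time_change
    (fun t => Real.sqrt (q t)) (hqs.sqrt fun t => (hqpos t).ne')
    (Real.sqrt (8 * (c - M) / ((M - m) * (M - z)))) (Real.sqrt_pos.2 hε0)
    (fun x => by
      apply Real.sqrt_le_sqrt
      have h1 := hψM x
      have h2 := hψm x
      exact div_le_div₀ (by linarith) (by linarith) (hden x)
        (mul_le_mul_of_nonneg_left (by linarith) (by linarith)))
  refine ⟨ψ ∘ t, hψs.comp hts, fun ξ => ⟨hψm _, hψM _⟩, by simp [ht0, hψ0], fun ξ => ?_,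
    hψtop.comp httop, hψbot.comp htbot, fun ξ => ?_⟩
  · simp only [Function.comp, ht0, hψ0]; exact hψM _
  · rw [hfac, ((hψd (t ξ)).comp ξ (htd ξ)).deriv]
    simp only [Function.comp]
    generalize t ξ = s
    have hs := Real.sq_sqrt (hqpos s).le
    rw [mul_pow, inv_pow, hs]
    have e1 : ψ s - m = (M - m) / Real.cosh s ^ 2 := by simp [hψ]
    have e2 : M - ψ s = (M - m) * Real.sinh s ^ 2 / Real.cosh s ^ 2 := by
      have := (hc s).ne'
      rw [Real.sinh_sq]; simp only [hψ]; field_simp; ring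
    rw [e1, e2]
    simp only [hq]
    have h3 : c - ψ s ≠ 0 := by linarith [hψM s]
    have h4 : ψ s - z ≠ 0 := by linarith [hψm s]
    have h5 : M - m ≠ 0 := by linarith
    have := (hc s).ne'
    generalize ψ s = p at *
    field_simp
    ring
end

section
/- Let m, c ∈ ℝ with m < c and 3m + c > 0, and let ξ₀ ∈ ℝ. Set C = (3m + c)/(c − m), D₄ = 4C²·(c − m)·(1 + √(1 + 1/C))², D₅ = √((3m + c)/2), D₆ = C·(1 + √(1 + 1/C))², and define φ : ℝ → ℝ by φ(ξ) = m + D₄·e^{−D₅|ξ−ξ₀|} / (D₆ − e^{−D₅|ξ−ξ₀|})². Then: (i) φ(ξ₀) = c; (ii) m < φ(ξ) ≤ c for all ξ; (iii) φ(ξ) → m as ξ → +∞ and as ξ → −∞; and (iv) for every ξ ≠ ξ₀, φ is differentiable at ξ and (φ'(ξ))² = (1/2)·(φ(ξ) − m)²·(φ(ξ) + 2m + c). -/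
open Filter Topology Real

/-- Explicit peakon with decay for the mCH equation: the profile
`φ(ξ) = m + D₄ e^{-D₅|ξ-ξ₀|}/(D₆ - e^{-D₅|ξ-ξ₀|})²` has peak value `c` at `ξ₀`,
decays to `m` at `±∞`, and satisfies `(φ')² = (1/2)(φ - m)²(φ + 2m + c)` off the peak. -/
theorem mCH_explicit_peakon_with_decay (m c ξ₀ : ℝ) (hmc : m < c) (hpos : 0 < 3 * m + c)
    (C D₄ D₅ D₆ : ℝ)
    (hC : C = (3 * m + c) / (c - m))
    (hD₄ : D₄ = 4 * C ^ 2 * (c - m) * (1 + Real.sqrt (1 + 1 / C)) ^ 2)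
    (hD₅ : D₅ = Real.sqrt ((3 * m + c) / 2))
    (hD₆ : D₆ = C * (1 + Real.sqrt (1 + 1 / C)) ^ 2)
    (φ : ℝ → ℝ)
    (hφ : ∀ ξ : ℝ,
      φ ξ = m + D₄ * Real.exp (-D₅ * |ξ - ξ₀|) / (D₆ - Real.exp (-D₅ * |ξ - ξ₀|)) ^ 2) :
    φ ξ₀ = c ∧
    (∀ ξ : ℝ, m < φ ξ ∧ φ ξ ≤ c) ∧
    Tendsto φ atTop (nhds m) ∧ Tendsto φ atBot (nhds m) ∧
    (∀ ξ : ℝ, ξ ≠ ξ₀ →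
      DifferentiableAt ℝ φ ξ ∧
      (deriv φ ξ) ^ 2 = (1 / 2) * (φ ξ - m) ^ 2 * (φ ξ + 2 * m + c)) := by
  have hcm : 0 < c - m := by linarith
  have hCpos : 0 < C := by rw [hC]; positivity
  have hCc : C * (c - m) = 3 * m + c := by rw [hC]; field_simp
  set s := Real.sqrt (1 + 1 / C) with hs
  have hs2 : s ^ 2 = 1 + 1 / C := Real.sq_sqrt (by positivity)
  have hs0 : 0 ≤ s := Real.sqrt_nonneg _
  have hCs : C * s ^ 2 = C + 1 := by rw [hs2]; field_simp
  have hD1 : D₆ - 1 = 2 * C * (1 + s) := by rw [hD₆]; linear_combination hCs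
  have hDgt : 1 < D₆ := by
    have : 0 < 2 * C * (1 + s) := by positivity
    linarith
  have hDsq : (D₆ - 1) ^ 2 = 4 * C * D₆ := by rw [hD1, hD₆]; ring
  have hK : D₄ = (c - m) * (D₆ - 1) ^ 2 := by rw [hDsq, hD₄, hD₆]; ring
  have hK2 : D₄ = 4 * (3 * m + c) * D₆ := by rw [hK, hDsq, ← hCc]; ring
  have hD₄pos : 0 < D₄ := by rw [hK2]; positivity
  have hD5pos : 0 < D₅ := by rw [hD₅]; exact Real.sqrt_pos.mpr (by linarith)
  have hD5sq : D₅ ^ 2 = (3 * m + c) / 2 := by rw [hD₅]; exact Real.sq_sqrt (by linarith)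
  have hE1 : ∀ ξ : ℝ, Real.exp (-D₅ * |ξ - ξ₀|) ≤ 1 := by
    intro ξ
    rw [Real.exp_le_one_iff]
    have := mul_nonneg hD5pos.le (abs_nonneg (ξ - ξ₀))
    linarith
  have hfun : φ = fun ξ => m + D₄ * Real.exp (-D₅ * |ξ - ξ₀|) /
      (D₆ - Real.exp (-D₅ * |ξ - ξ₀|)) ^ 2 := funext hφ
  have hlim : ∀ l : Filter ℝ, Tendsto (fun ξ : ℝ => |ξ - ξ₀|) l atTop → Tendsto φ l (nhds m) := by
    intro l hl
    have h1 : Tendsto (fun ξ : ℝ => Real.exp (-D₅ * |ξ - ξ₀|)) l (nhds 0) :=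
      Real.tendsto_exp_atBot.comp (hl.const_mul_atTop_of_neg (by linarith))
    have h2 := ((h1.const_mul D₄).div ((h1.const_sub D₆).pow 2)
      (by rw [sub_zero]; positivity)).const_add m
    rw [hfun]
    simpa using h2
  refine ⟨?_, ?_, ?_, ?_, ?_⟩
  · rw [hφ]
    have : D₆ - 1 ≠ 0 := by linarith
    simp only [sub_self, abs_zero, mul_zero, Real.exp_zero, mul_one]
    rw [hK]; field_simp; ring
  · intro ξ
    rw [hφ]
    have he := Real.exp_pos (-D₅ * |ξ - ξ₀|)
    have he1 := hE1 ξ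
    generalize Real.exp (-D₅ * |ξ - ξ₀|) = e at *
    have hd : 0 < D₆ - e := by linarith
    constructor
    · have : 0 < D₄ * e / (D₆ - e) ^ 2 := by positivity
      linarith
    · have : D₄ * e / (D₆ - e) ^ 2 ≤ c - m := by
        rw [div_le_iff₀ (by positivity), hK, mul_assoc]
        apply mul_le_mul_of_nonneg_left _ hcm.le
        have h1 : (D₆ - 1) ^ 2 ≤ (D₆ - e) ^ 2 :=
          pow_le_pow_left₀ (by linarith) (by linarith) 2
        nlinarith [sq_nonneg (D₆ - 1)]
      linarith
  · apply hlim
    exact tendsto_abs_atTop_atTop.comp (tendsto_atTop_add_const_right _ (-ξ₀) tendsto_id)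
  · apply hlim
    exact tendsto_abs_atBot_atTop.comp (tendsto_atBot_add_const_right _ (-ξ₀) tendsto_id)
  · intro ξ hξ
    obtain ⟨σ, hσ, habs⟩ : ∃ σ : ℝ, σ ^ 2 = 1 ∧
        HasDerivAt (fun ξ : ℝ => |ξ - ξ₀|) σ ξ := by
      have hlin : HasDerivAt (fun ξ : ℝ => ξ - ξ₀) 1 ξ := (hasDerivAt_id ξ).sub_const ξ₀
      rcases lt_or_gt_of_ne hξ with h | h
      · refine ⟨-1, by norm_num, ?_⟩
        simpa [Function.comp_def] using (hasDerivAt_abs_neg (sub_neg.mpr h)).comp ξ hlin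
      · refine ⟨1, by norm_num, ?_⟩
        simpa [Function.comp_def] using (hasDerivAt_abs_pos (sub_pos.mpr h)).comp ξ hlin
    have hexp := (habs.const_mul (-D₅)).exp
    have he1 := hE1 ξ
    have hd : D₆ - Real.exp (-D₅ * |ξ - ξ₀|) ≠ 0 := by linarith
    have hder := ((hexp.const_mul D₄).fun_div ((hexp.const_sub D₆).fun_pow 2)
      (pow_ne_zero 2 hd)).const_add m
    rw [← hfun] at hder
    refine ⟨hder.differentiableAt, ?_⟩
    rw [hder.deriv, hφ]
    generalize Real.exp (-D₅ * |ξ - ξ₀|) = e at *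
    have hy : D₄ * e / (D₆ - e) ^ 2 + (3 * m + c) =
        (3 * m + c) * (D₆ + e) ^ 2 / (D₆ - e) ^ 2 := by
      rw [hK2]; field_simp; ring
    have hL : (D₄ * (e * (-D₅ * σ)) * (D₆ - e) ^ 2 -
        D₄ * e * (((2 : ℕ) : ℝ) * (D₆ - e) ^ (2 - 1) * -(e * (-D₅ * σ)))) / ((D₆ - e) ^ 2) ^ 2
        = -(D₅ * σ) * (D₄ * e * (D₆ + e) / (D₆ - e) ^ 3) := by
      field_simp; push_cast; ring
    rw [hL, show m + D₄ * e / (D₆ - e) ^ 2 + 2 * m + c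
      = D₄ * e / (D₆ - e) ^ 2 + (3 * m + c) by ring, hy, mul_pow, neg_sq, mul_pow, hσ, hD5sq]
    field_simp
    ring
end

section
/- Let c, a, d, m, M, z, r ∈ ℝ with z < r < m < M < c, and suppose that for every y ∈ ℝ: y²·(c − y²/2) + a·y + d = (1/2)·(M − y)·(y − m)·(y − z)·(y − r). Then there exist L > 0 and a C^∞ function φ : ℝ → ℝ which is periodic with period L, satisfies m ≤ φ(ξ) ≤ M for all ξ, attains both values m and M, satisfies (φ'(ξ))²·(c − φ(ξ)) = φ(ξ)²·(c − φ(ξ)²/2) + a·φ(ξ) + d for all ξ ∈ ℝ, and satisfies the traveling-wave equation −c·φ' + c·φ''' = φ·φ''' + 2φ'·φ'' − 3φ²·φ' on ℝ. -/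
/-- Global flow of the scalar autonomous equation `dθ = g(θ) dx` with `g` positive, smooth and
`2π`-periodic. -/
lemma mCH_aux_flow (g : ℝ → ℝ) (hg : ContDiff ℝ (⊤ : ℕ∞) g) (hpos : ∀ t, 0 < g t)
    (hper : Function.Periodic g (2 * Real.pi)) :
    ∃ (L : ℝ) (θ : ℝ → ℝ), 0 < L ∧ ContDiff ℝ (⊤ : ℕ∞) θ ∧
      (∀ x, HasDerivAt θ (g (θ x)) x) ∧ (∀ x, θ (x + L) = θ x + 2 * Real.pi) ∧
      Function.Surjective θ := by
  have hpi : 0 < 2 * Real.pi := by positivity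
  have hc : Continuous (fun t => (g t)⁻¹) := hg.continuous.inv₀ (fun t => (hpos t).ne')
  have hper' : Function.Periodic (fun t => (g t)⁻¹) (2 * Real.pi) := fun t => by
    simp only [hper t]
  have hII : ∀ u v, IntervalIntegrable (fun t => (g t)⁻¹) MeasureTheory.volume u v :=
    fun u v => hc.intervalIntegrable u v
  let T : ℝ → ℝ := fun x => ∫ t in (0 : ℝ)..x, (g t)⁻¹
  have hT : ∀ x, HasDerivAt T (g x)⁻¹ x := fun x =>
    intervalIntegral.integral_hasDerivAt_right (hII 0 x)
      (hc.stronglyMeasurableAtFilter _ _) hc.continuousAt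
  have hmono : StrictMono T := strictMono_of_deriv_pos (fun x => by
    rw [(hT x).deriv]; exact inv_pos.2 (hpos x))
  have hTc : Continuous T := continuous_iff_continuousAt.2 fun x => (hT x).continuousAt
  have hL : 0 < T (2 * Real.pi) := by
    have h := hmono hpi
    simpa [T] using h
  have htop : Filter.Tendsto T Filter.atTop Filter.atTop :=
    hper'.tendsto_atTop_intervalIntegral_of_pos hL hpi
  have hbot : Filter.Tendsto T Filter.atBot Filter.atBot :=
    hper'.tendsto_atBot_intervalIntegral_of_pos hL hpi
  have hsurj : Function.Surjective T := hTc.surjective htop hbot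
  let e : ℝ ≃o ℝ := hmono.orderIsoOfSurjective T hsurj
  have heT : ∀ x, e x = T x := fun x => rfl
  have hTe : ∀ x, T (e.symm x) = x := fun x => e.apply_symm_apply x
  have heT' : ∀ x, e.symm (T x) = x := fun x => e.symm_apply_apply x
  have hd : ∀ x, HasDerivAt e.symm (g (e.symm x)) x := fun x => by
    have := HasDerivAt.of_local_left_inverse (f := T) (g := e.symm) (a := x)
      (e.symm.continuous.continuousAt) (hT (e.symm x)) (inv_ne_zero (hpos _).ne')
      (Filter.Eventually.of_forall hTe)
    simpa using this
  refine ⟨T (2 * Real.pi), e.symm, hL, ?_, hd, ?_, e.symm.surjective⟩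
  · rw [contDiff_infty]
    intro n
    induction n with
    | zero => exact contDiff_zero.2 e.symm.continuous
    | succ n ih =>
      push_cast
      rw [contDiff_succ_iff_deriv]
      refine ⟨fun x => (hd x).differentiableAt, by simp, ?_⟩
      have : deriv e.symm = fun x => g (e.symm x) := funext fun x => (hd x).deriv
      rw [this]
      exact (contDiff_infty.1 hg n).comp ih
  · intro x
    apply hmono.injective
    have h : T (e.symm x + 2 * Real.pi) = T (e.symm x) + T (2 * Real.pi) := by
      have h1 := hper'.intervalIntegral_add_eq_add 0 (e.symm x) hII
      simpa [T] using h1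
    rw [h, hTe, hTe]

/-- Smooth periodic traveling waves of the mCH equation in the case of four simple real
zeros `z < r < m < M < c` of the quartic `P(y) = y²(c - y²/2) + ay + d`. -/
theorem mCH_smooth_periodic_four_zeros (c a d m M z r : ℝ)
    (hzr : z < r) (hrm : r < m) (hmM : m < M) (hMc : M < c)
    (hfac : ∀ y : ℝ,
      y ^ 2 * (c - y ^ 2 / 2) + a * y + d =
        (1 / 2) * (M - y) * (y - m) * (y - z) * (y - r)) :
    ∃ (L : ℝ) (φ : ℝ → ℝ), 0 < L ∧
      ContDiff ℝ (⊤ : ℕ∞) φ ∧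
      Function.Periodic φ L ∧
      (∀ ξ : ℝ, m ≤ φ ξ ∧ φ ξ ≤ M) ∧
      (∃ ξ : ℝ, φ ξ = m) ∧ (∃ ξ : ℝ, φ ξ = M) ∧
      (∀ ξ : ℝ,
        (deriv φ ξ) ^ 2 * (c - φ ξ) =
          (φ ξ) ^ 2 * (c - (φ ξ) ^ 2 / 2) + a * φ ξ + d) ∧
      (∀ ξ : ℝ,
        -c * deriv φ ξ + c * iteratedDeriv 3 φ ξ =
          φ ξ * iteratedDeriv 3 φ ξ + 2 * deriv φ ξ * iteratedDeriv 2 φ ξ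
            - 3 * (φ ξ) ^ 2 * deriv φ ξ) := by
  obtain ⟨A, hA⟩ : ∃ A, A = (M + m) / 2 := ⟨_, rfl⟩
  obtain ⟨B, hB⟩ : ∃ B, B = (M - m) / 2 := ⟨_, rfl⟩
  have hM : M = A + B := by rw [hA, hB]; ring
  have hm : m = A - B := by rw [hA, hB]; ring
  have hB0 : 0 < B := by rw [hB]; linarith
  let f : ℝ → ℝ := fun t => A - B * Real.cos t
  have hfm : ∀ t, m ≤ f t := fun t => by
    have := Real.cos_le_one t
    simp only [f, hm]; nlinarith
  have hfM : ∀ t, f t ≤ M := fun t => by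
    have := Real.neg_one_le_cos t
    simp only [f, hM]; nlinarith
  have hfs : ContDiff ℝ (⊤ : ℕ∞) f := by
    simp only [f]; exact contDiff_const.sub (contDiff_const.mul Real.contDiff_cos)
  have hfd : ∀ t, HasDerivAt f (B * Real.sin t) t := fun t => by
    have := ((Real.hasDerivAt_cos t).const_mul B).const_sub A
    simpa [f] using this
  have hcf : ∀ t, 0 < c - f t := fun t => by linarith [hfM t]
  have hH : ∀ t, 0 < (f t - z) * (f t - r) / (2 * (c - f t)) := fun t => by
    have h1 : 0 < f t - z := by linarith [hfm t]
    have h2 : 0 < f t - r := by linarith [hfm t]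
    have h3 := hcf t
    positivity
  let g : ℝ → ℝ := fun t => Real.sqrt ((f t - z) * (f t - r) / (2 * (c - f t)))
  have hgpos : ∀ t, 0 < g t := fun t => Real.sqrt_pos.2 (hH t)
  have hg2 : ∀ t, g t ^ 2 * (2 * (c - f t)) = (f t - z) * (f t - r) := fun t => by
    have h3 := hcf t
    simp only [g]
    rw [Real.sq_sqrt (hH t).le]
    field_simp
  have hgs : ContDiff ℝ (⊤ : ℕ∞) g := by
    refine ContDiff.sqrt ?_ (fun t => (hH t).ne')
    refine ContDiff.div ((hfs.sub contDiff_const).mul (hfs.sub contDiff_const))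
      (contDiff_const.mul (contDiff_const.sub hfs)) (fun t => ?_)
    have := hcf t
    positivity
  have hgper : Function.Periodic g (2 * Real.pi) := fun t => by
    simp only [g, f, Real.cos_add_two_pi]
  obtain ⟨L, θ, hL, hθs, hθd, hθL, hθsurj⟩ := mCH_aux_flow g hgs hgpos hgper
  -- derivative of g
  have hgd : ∀ t, HasDerivAt g (deriv g t) t := fun t =>
    (hgs.differentiable (by simp) t).hasDerivAt
  have hg1 : ∀ t, 2 * g t * deriv g t * (2 * (c - f t)) - 2 * g t ^ 2 * (B * Real.sin t)
      = (2 * f t - z - r) * (B * Real.sin t) := fun t => by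
    have e1 := ((hgd t).fun_pow 2).fun_mul (((hfd t).const_sub c).const_mul 2)
    have e2 := ((hfd t).sub_const z).fun_mul ((hfd t).sub_const r)
    have e3 : (fun t => g t ^ 2 * (2 * (c - f t))) = fun t => (f t - z) * (f t - r) :=
      funext hg2
    rw [e3] at e1
    have := e1.unique e2
    push_cast at this
    linear_combination this
  -- derivative of the quartic identity
  have hP' : ∀ y : ℝ, 2 * c * y - 2 * y ^ 3 + a =
      (1 / 2) * ((M + m - 2 * y) * ((y - z) * (y - r))
        + (M - y) * (y - m) * (2 * y - z - r)) := fun y => by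
    have i1 := hasDerivAt_id' y
    have e1 := (((i1.fun_pow 2).fun_mul (((i1.fun_pow 2).div_const 2).const_sub c)).fun_add
      (i1.const_mul a)).add_const d
    have e2 := ((((i1.const_sub M).const_mul (1 / 2)).fun_mul (i1.sub_const m)).fun_mul
      (i1.sub_const z)).fun_mul (i1.sub_const r)
    rw [funext hfac] at e1
    have := e1.unique e2
    push_cast at this
    linear_combination this
  let φ : ℝ → ℝ := fun x => f (θ x)
  have hφs : ContDiff ℝ (⊤ : ℕ∞) φ := hfs.comp hθs
  have hφ1 : ∀ x, HasDerivAt φ (B * Real.sin (θ x) * g (θ x)) x := fun x =>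
    (hfd (θ x)).comp x (hθd x)
  have hD1 : deriv φ = fun x => B * Real.sin (θ x) * g (θ x) := funext fun x => (hφ1 x).deriv
  have hφ2 : ∀ x, HasDerivAt (deriv φ) (B * (Real.cos (θ x) * g (θ x)) * g (θ x)
      + B * Real.sin (θ x) * (deriv g (θ x) * g (θ x))) x := fun x => by
    rw [hD1]
    exact ((hθd x).sin.const_mul B).fun_mul ((hgd (θ x)).comp x (hθd x))
  have hI2 : iteratedDeriv 2 φ = deriv (deriv φ) := by
    rw [iteratedDeriv_succ, iteratedDeriv_one]
  have hI3 : iteratedDeriv 3 φ = deriv (iteratedDeriv 2 φ) := by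
    rw [iteratedDeriv_succ]
  have hdiff2 : Differentiable ℝ (iteratedDeriv 2 φ) :=
    hφs.differentiable_iteratedDeriv 2 (WithTop.coe_lt_coe.2 (ENat.natCast_lt_top 2))
  have hE1 : ∀ x, deriv φ x ^ 2 * (c - φ x) =
      φ x ^ 2 * (c - φ x ^ 2 / 2) + a * φ x + d := fun x => by
    rw [hfac, (hφ1 x).deriv]
    have h := hg2 (θ x)
    have hs := Real.sin_sq_add_cos_sq (θ x)
    have hφx : φ x = A - B * Real.cos (θ x) := rfl
    have hfx : f (θ x) = φ x := rfl
    rw [hfx] at h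
    have hq : (M - φ x) * (φ x - m) = B ^ 2 * Real.sin (θ x) ^ 2 := by
      rw [hφx, hM, hm]; linear_combination (-B ^ 2) * hs
    linear_combination (1 / 2) * B ^ 2 * Real.sin (θ x) ^ 2 * h
      - (1 / 2) * (φ x - z) * (φ x - r) * hq
  have hE2 : ∀ x, 2 * iteratedDeriv 2 φ x * (c - φ x) - deriv φ x ^ 2 =
      2 * c * φ x - 2 * φ x ^ 3 + a := fun x => by
    rw [hP', hI2, (hφ2 x).deriv, (hφ1 x).deriv]
    have h := hg2 (θ x)
    have h' := hg1 (θ x)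
    have hs := Real.sin_sq_add_cos_sq (θ x)
    have hφx : φ x = A - B * Real.cos (θ x) := rfl
    have hfx : f (θ x) = φ x := rfl
    rw [hfx] at h h'
    have hq : (M - φ x) * (φ x - m) = B ^ 2 * Real.sin (θ x) ^ 2 := by
      rw [hφx, hM, hm]; linear_combination (-B ^ 2) * hs
    have hq' : M + m - 2 * φ x = 2 * B * Real.cos (θ x) := by
      rw [hφx, hM, hm]; ring
    rw [hq, hq']
    linear_combination B * Real.cos (θ x) * h + (1 / 2) * B * Real.sin (θ x) * h'
  refine ⟨L, φ, hL, hφs, ?_, fun x => ⟨hfm _, hfM _⟩, ?_, ?_, hE1, ?_⟩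
  · intro x
    simp only [φ, f, hθL, Real.cos_add_two_pi]
  · obtain ⟨x, hx⟩ := hθsurj 0
    exact ⟨x, by simp [φ, f, hx, hm]⟩
  · obtain ⟨x, hx⟩ := hθsurj Real.pi
    exact ⟨x, by simp [φ, f, hx, hM]⟩
  · intro x
    have d0 : HasDerivAt φ (deriv φ x) x := (hφ1 x).differentiableAt.hasDerivAt
    have d1 : HasDerivAt (deriv φ) (iteratedDeriv 2 φ x) x := by
      rw [hI2]; exact (hφ2 x).differentiableAt.hasDerivAt
    have d2 : HasDerivAt (iteratedDeriv 2 φ) (iteratedDeriv 3 φ x) x := by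
      rw [hI3]; exact (hdiff2 x).hasDerivAt
    have e1 := ((d2.const_mul 2).fun_mul (d0.const_sub c)).fun_sub (d1.fun_pow 2)
    have e2 := ((d0.const_mul (2 * c)).fun_sub ((d0.fun_pow 3).const_mul 2)).add_const a
    rw [funext hE2] at e1
    have := e1.unique e2
    push_cast at this
    linear_combination (1 / 2) * this
end
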